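/- Composite corrected trapezoidal rule: Let a < b be real numbers, let n ≥ 1 be a natural number, and let f be twice continuously differentiable on [a,b]. For 0 ≤ i ≤ n set x_i = a + (b−a)i/n. Then |∫_a^b f(x) dx − ((b−a)/(2n))·(f(a) + 2∑_{i=1}^{n−1} f(x_i) + f(b)) − (3(b−a)^2/(32 n^2))·(f'(a)−f'(b))| ≤ (b−a)^3 · ‖f''‖_∞ / (32 n^2). -/

import Mathlib

open MeasureTheory intervalIntegral

/-- The integral of a quadratic Peano kernel against `f''`, by two integrations by parts. -/
lemma integral_quadratic_kernel_mul {c d : ℝ} (hcd : c ≤ d) {f f' f'' : ℝ → ℝ} (m r : ℝ)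
    (hf : ∀ x ∈ Set.Icc c d, HasDerivWithinAt f (f' x) (Set.Icc c d) x)
    (hf' : ∀ x ∈ Set.Icc c d, HasDerivWithinAt f' (f'' x) (Set.Icc c d) x)
    (hf'' : ContinuousOn f'' (Set.Icc c d)) :
    ∫ x in c..d, ((x - m) ^ 2 / 2 - r) * f'' x =
      (∫ x in c..d, f x) +
        ((((d - m) ^ 2 / 2 - r) * f' d - (d - m) * f d) -
          (((c - m) ^ 2 / 2 - r) * f' c - (c - m) * f c)) := by
  have hfc : ContinuousOn f (Set.Icc c d) := fun x hx => (hf x hx).continuousWithinAt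
  have hf'c : ContinuousOn f' (Set.Icc c d) := fun x hx => (hf' x hx).continuousWithinAt
  have hKc : ContinuousOn (fun x : ℝ => ((x - m) ^ 2 / 2 - r) * f'' x) (Set.Icc c d) := by
    fun_prop
  have hfi : IntervalIntegrable f volume c d := hfc.intervalIntegrable_of_Icc hcd
  have hKi := hKc.intervalIntegrable_of_Icc (μ := volume) hcd
  have key := integral_eq_sub_of_hasDerivAt_of_le hcd
    (f := fun x => ((x - m) ^ 2 / 2 - r) * f' x - (x - m) * f x)
    (f' := fun x => ((x - m) ^ 2 / 2 - r) * f'' x - f x) (by fun_prop)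
    (fun x hx => by
      have hx' := Set.Ioo_subset_Icc_self hx
      have hn := Icc_mem_nhds hx.1 hx.2
      have h1 := (hf x hx').hasDerivAt hn
      have h2 := (hf' x hx').hasDerivAt hn
      have h3 : HasDerivAt (fun x : ℝ => x - m) 1 x := (hasDerivAt_id x).sub_const m
      have h4 : HasDerivAt (fun x : ℝ => (x - m) ^ 2 / 2 - r) (x - m) x :=
        (((h3.fun_pow 2).div_const 2).sub_const r).congr_deriv (by norm_num)
      exact ((h4.mul h2).sub (h3.mul h1)).congr_deriv (by ring))
    (hKi.sub hfi)
  rw [integral_sub hKi hfi] at key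
  linarith

/-- Weighted bound for the integral of a product whose first factor is dominated by a quadratic. -/
lemma abs_integral_mul_le_of_abs_le_quadratic {p q : ℝ} (hpq : p ≤ q) {K g : ℝ → ℝ}
    {M m s r : ℝ} (hg : ∀ x ∈ Set.Icc p q, |g x| ≤ M)
    (hK : ∀ x ∈ Set.Icc p q, |K x| ≤ s * (x - m) ^ 2 - r) :
    |∫ x in p..q, K x * g x| ≤
      M * (s * ((q - m) ^ 3 - (p - m) ^ 3) / 3 - r * (q - p)) := by
  have h : ‖∫ x in p..q, K x * g x‖ ≤ ∫ x in p..q, M * (s * (x - m) ^ 2 - r) := by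
    refine norm_integral_le_of_norm_le hpq (ae_of_all _ fun x hx => ?_)
      (Continuous.intervalIntegrable (by fun_prop) _ _)
    have hx' := Set.Ioc_subset_Icc_self hx
    rw [Real.norm_eq_abs, abs_mul, mul_comm]
    exact mul_le_mul (hg x hx') (hK x hx') (abs_nonneg _) ((abs_nonneg _).trans (hg x hx'))
  refine h.trans_eq ?_
  have hd : ∀ x ∈ Set.uIcc p q, HasDerivAt
      (fun x => M * (s * (x - m) ^ 3 / 3 - r * x)) (M * (s * (x - m) ^ 2 - r)) x := by
    intro x _
    have h3 : HasDerivAt (fun x : ℝ => x - m) 1 x := (hasDerivAt_id x).sub_const m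
    exact (((((h3.fun_pow 3).const_mul s).div_const 3).sub
      ((hasDerivAt_id x).const_mul r)).const_mul M).congr_deriv (by push_cast; ring)
  rw [integral_eq_sub_of_hasDerivAt hd (Continuous.intervalIntegrable (by fun_prop) _ _)]
  ring

/-- Corrected trapezoidal rule on a single interval. -/
lemma abs_corrected_trapezoid_error_le {c d : ℝ} (hcd : c ≤ d) {f f' f'' : ℝ → ℝ} {M : ℝ}
    (hf : ∀ x ∈ Set.Icc c d, HasDerivWithinAt f (f' x) (Set.Icc c d) x)
    (hf' : ∀ x ∈ Set.Icc c d, HasDerivWithinAt f' (f'' x) (Set.Icc c d) x)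
    (hf'' : ContinuousOn f'' (Set.Icc c d)) (hM : ∀ x ∈ Set.Icc c d, |f'' x| ≤ M) :
    |(∫ x in c..d, f x) - (d - c) / 2 * (f c + f d) -
        3 * (d - c) ^ 2 / 32 * (f' c - f' d)| ≤ (d - c) ^ 3 / 32 * M := by
  obtain ⟨h, rfl⟩ : ∃ h, d = c + 4 * h := ⟨(d - c) / 4, by ring⟩
  have hh : 0 ≤ h := by linarith
  set K : ℝ → ℝ := fun x => (x - (c + 2 * h)) ^ 2 / 2 - h ^ 2 / 2 with hKdef
  have key : ∫ x in c..(c + 4 * h), K x * f'' x = _ :=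
    integral_quadratic_kernel_mul hcd (c + 2 * h) (h ^ 2 / 2) hf hf' hf''
  have hc : ContinuousOn (fun x => K x * f'' x) (Set.Icc c (c + 4 * h)) := by
    simp only [hKdef]
    fun_prop
  have hi : ∀ p q, c ≤ p → p ≤ q → q ≤ c + 4 * h →
      IntervalIntegrable (fun x => K x * f'' x) volume p q := fun p q h1 h2 h3 =>
    (hc.mono (Set.Icc_subset_Icc h1 h3)).intervalIntegrable_of_Icc h2
  have hi1 := hi c (c + h) le_rfl (by linarith) (by linarith)
  have hi2 := hi (c + h) (c + 3 * h) (by linarith) (by linarith) (by linarith)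
  have hi3 := hi (c + 3 * h) (c + 4 * h) (by linarith) (by linarith) le_rfl
  rw [← integral_add_adjacent_intervals (hi1.trans hi2) hi3,
    ← integral_add_adjacent_intervals hi1 hi2] at key
  have b1 := abs_integral_mul_le_of_abs_le_quadratic (p := c) (q := c + h) (K := K) (g := f'')
    (M := M) (m := c + 2 * h) (s := 1 / 2) (r := h ^ 2 / 2) (by linarith)
    (fun x hx => hM x ⟨hx.1, by linarith [hx.2]⟩) (fun x hx => by
      have h1 := hx.1
      have h2 := hx.2
      rw [abs_of_nonneg] <;> simp only [hKdef] <;> nlinarith)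
  have b2 := abs_integral_mul_le_of_abs_le_quadratic (p := c + h) (q := c + 3 * h) (K := K)
    (g := f'') (M := M) (m := c + 2 * h) (s := -(1 / 2)) (r := -(h ^ 2 / 2)) (by linarith)
    (fun x hx => hM x ⟨by linarith [hx.1], by linarith [hx.2]⟩) (fun x hx => by
      have h1 := hx.1
      have h2 := hx.2
      rw [abs_of_nonpos] <;> simp only [hKdef] <;> nlinarith)
  have b3 := abs_integral_mul_le_of_abs_le_quadratic (p := c + 3 * h) (q := c + 4 * h) (K := K)
    (g := f'') (M := M) (m := c + 2 * h) (s := 1 / 2) (r := h ^ 2 / 2) (by linarith)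
    (fun x hx => hM x ⟨by linarith [hx.1], hx.2⟩) (fun x hx => by
      have h1 := hx.1
      have h2 := hx.2
      rw [abs_of_nonneg] <;> simp only [hKdef] <;> nlinarith)
  have hE : (∫ x in c..(c + 4 * h), f x) - (c + 4 * h - c) / 2 * (f c + f (c + 4 * h)) -
      3 * (c + 4 * h - c) ^ 2 / 32 * (f' c - f' (c + 4 * h)) =
      (∫ x in c..(c + h), K x * f'' x) + (∫ x in (c + h)..(c + 3 * h), K x * f'' x) +
        ∫ x in (c + 3 * h)..(c + 4 * h), K x * f'' x := by
    rw [key]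
    ring
  rw [hE]
  refine (abs_add_three _ _ _).trans ((add_le_add (add_le_add b1 b2) b3).trans_eq ?_)
  ring

lemma sum_range_add_succ_eq (g : ℕ → ℝ) {n : ℕ} (hn : 1 ≤ n) :
    ∑ i ∈ Finset.range n, (g i + g (i + 1)) =
      g 0 + 2 * ∑ i ∈ Finset.Icc 1 (n - 1), g i + g n := by
  induction n, hn using Nat.le_induction with
  | base => simp
  | succ k hk ih =>
    obtain ⟨j, rfl⟩ : ∃ j, k = j + 1 := ⟨k - 1, by omega⟩
    rw [Finset.sum_range_succ, ih]
    simp only [Nat.add_sub_cancel]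
    rw [Finset.sum_Icc_succ_top (by omega)]
    ring

/-- Composite corrected trapezoidal rule. -/
theorem composite_corrected_trapezoidal_rule (a b : ℝ) (hab : a < b) (n : ℕ) (hn : 1 ≤ n)
    (f f' f'' : ℝ → ℝ)
    (hf : ∀ x ∈ Set.Icc a b, HasDerivWithinAt f (f' x) (Set.Icc a b) x)
    (hf' : ∀ x ∈ Set.Icc a b, HasDerivWithinAt f' (f'' x) (Set.Icc a b) x)
    (hf'' : ContinuousOn f'' (Set.Icc a b)) :
    |(∫ x in a..b, f x) -
        (b - a) / (2 * n) *
          (f a + 2 * ∑ i ∈ Finset.Icc 1 (n - 1), f (a + (b - a) * (i : ℝ) / n) + f b) -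
        3 * (b - a) ^ 2 / (32 * (n : ℝ) ^ 2) * (f' a - f' b)| ≤
      (b - a) ^ 3 * sSup ((fun x => |f'' x|) '' Set.Icc a b) / (32 * (n : ℝ) ^ 2) := by
  set M := sSup ((fun x => |f'' x|) '' Set.Icc a b)
  have hM : ∀ x ∈ Set.Icc a b, |f'' x| ≤ M := fun x hx =>
    le_csSup (isCompact_Icc.image_of_continuousOn hf''.abs).bddAbove (Set.mem_image_of_mem _ hx)
  have hn0 : (0 : ℝ) < n := by exact_mod_cast hn
  have hfc : ContinuousOn f (Set.Icc a b) := fun x hx => (hf x hx).continuousWithinAt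
  set X : ℕ → ℝ := fun i => a + (b - a) * (i : ℝ) / n with hX
  have hX0 : X 0 = a := by simp [hX]
  have hXn : X n = b := by simp only [hX]; field_simp; ring
  have hstep : ∀ i, X (i + 1) - X i = (b - a) / n := fun i => by
    simp only [hX]; push_cast; field_simp; ring
  have hh : 0 < (b - a) / n := div_pos (sub_pos.2 hab) hn0
  have hmono : Monotone X := monotone_nat_of_le_succ fun i => by linarith [hstep i]
  have hsub : ∀ i < n, Set.Icc (X i) (X (i + 1)) ⊆ Set.Icc a b := fun i hi => by
    rw [← hX0, ← hXn]
    exact Set.Icc_subset_Icc (hmono (Nat.zero_le i)) (hmono hi)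
  have hsplit : ∑ i ∈ Finset.range n, ∫ x in X i..X (i + 1), f x = ∫ x in a..b, f x := by
    rw [sum_integral_adjacent_intervals, hX0, hXn]
    exact fun i hi => (hfc.mono (hsub i hi)).intervalIntegrable_of_Icc (hmono i.le_succ)
  have hpiece : ∀ i ∈ Finset.range n,
      |(∫ x in X i..X (i + 1), f x) - (b - a) / n / 2 * (f (X i) + f (X (i + 1))) -
        3 * ((b - a) / n) ^ 2 / 32 * (f' (X i) - f' (X (i + 1)))| ≤
      ((b - a) / n) ^ 3 / 32 * M := fun i hi => by
    have hs := hsub i (Finset.mem_range.1 hi)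
    simpa only [hstep] using abs_corrected_trapezoid_error_le (hmono i.le_succ)
      (fun x hx => (hf x (hs hx)).mono hs) (fun x hx => (hf' x (hs hx)).mono hs)
      (hf''.mono hs) (fun x hx => hM x (hs hx))
  have htrap := sum_range_add_succ_eq (fun i => f (X i)) hn
  have htel := Finset.sum_range_sub' (fun i => f' (X i)) n
  simp only [hX0, hXn] at htrap htel
  have hsum := (Finset.abs_sum_le_sum_abs _ _).trans (Finset.sum_le_sum hpiece)
  rw [Finset.sum_sub_distrib, Finset.sum_sub_distrib, ← Finset.mul_sum, ← Finset.mul_sum, hsplit,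
    htrap, htel, Finset.sum_const, Finset.card_range, nsmul_eq_mul] at hsum
  have hw : (b - a) / (2 * n) = (b - a) / n / 2 := by field_simp
  have hw' : 3 * (b - a) ^ 2 / (32 * (n : ℝ) ^ 2) = 3 * ((b - a) / n) ^ 2 / 32 := by field_simp
  have hbound : (b - a) ^ 3 * M / (32 * (n : ℝ) ^ 2) = n * (((b - a) / n) ^ 3 / 32 * M) := by
    field_simp
  rw [hw, hw', hbound]
  exact hsum
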